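/- arXiv:2106.01135 — 8 statements merged into one kernel-verified Lean document; each statement's English description precedes it below -/
import Mathlib

section
/- Let S be a finite set of products and, for each i ∈ S, let r_i ≥ 0 and real numbers v_i^LCB, v_i, v_i^UCB with 0 ≤ v_i^LCB ≤ v_i ≤ v_i^UCB ≤ 1. Then Σ_{i∈S} r_i · v_i^UCB/(1 + Σ_{j∈S} v_j^LCB) − Σ_{i∈S} r_i · v_i/(1 + Σ_{j∈S} v_j) ≤ Σ_{i∈S} (r_i/(1 + Σ_{j∈S} v_j)) · [ (v_i^UCB − v_i) + Σ_{j∈S} (v_j − v_j^LCB) ]. -/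
/-- Increasing the denominator of `u / (1 + L)` to `1 + V` and changing its numerator to `w` lowers
the ratio by at most `((u - w) + (V - L)) / (1 + V)` when `u ≤ 1`. -/
theorem div_one_add_sub_div_one_add_le {u w L V : ℝ} (hu : u ≤ 1) (hL : 0 ≤ L) (hLV : L ≤ V) :
    u / (1 + L) - w / (1 + V) ≤ ((u - w) + (V - L)) / (1 + V) := by
  have hL' : 0 < 1 + L := by linarith
  have hV' : 0 < 1 + V := by linarith
  rw [sub_le_iff_le_add, ← add_div, div_le_div_iff₀ hL' hV']
  nlinarith [mul_nonneg (sub_nonneg.2 hLV) (sub_nonneg.2 hu), mul_nonneg (sub_nonneg.2 hLV) hL]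

/-- MNL upper-confidence revenue gap bound (Lemma: difference between the
optimistic revenue estimate and the true expected revenue). -/
theorem stmt_0 {ι : Type*} (S : Finset ι) (r v vLCB vUCB : ι → ℝ)
    (hr : ∀ i ∈ S, 0 ≤ r i)
    (hL0 : ∀ i ∈ S, 0 ≤ vLCB i)
    (hLv : ∀ i ∈ S, vLCB i ≤ v i)
    (hvU : ∀ i ∈ S, v i ≤ vUCB i)
    (hU1 : ∀ i ∈ S, vUCB i ≤ 1) :
    (∑ i ∈ S, r i * vUCB i / (1 + ∑ j ∈ S, vLCB j))
      - (∑ i ∈ S, r i * v i / (1 + ∑ j ∈ S, v j))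
    ≤ ∑ i ∈ S, (r i / (1 + ∑ j ∈ S, v j)) *
        ((vUCB i - v i) + ∑ j ∈ S, (v j - vLCB j)) := by
  rw [← Finset.sum_sub_distrib, Finset.sum_sub_distrib v vLCB]
  refine Finset.sum_le_sum fun i hi => ?_
  have key := mul_le_mul_of_nonneg_left
    (div_one_add_sub_div_one_add_le (w := v i) (hU1 i hi) (Finset.sum_nonneg hL0)
      (Finset.sum_le_sum hLv)) (hr i hi)
  rwa [mul_sub, ← mul_div_assoc, ← mul_div_assoc, ← mul_div_assoc, mul_div_right_comm (r i) (_ + _)]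
    at key
end

section
/- Let S be a finite set of products and, for each i ∈ S, let real numbers v_i^LCB, v_i, v_i^UCB satisfy 0 ≤ v_i^LCB ≤ v_i ≤ v_i^UCB and v_i ≤ 1. Then for every i ∈ S, v_i/(1 + Σ_{j∈S} v_j) − v_i^LCB/(1 + Σ_{j∈S} v_j^UCB) ≤ (1/(1 + Σ_{j∈S} v_j)) · [ (v_i − v_i^LCB) + Σ_{j∈S} (v_j^UCB − v_j) ]. -/
/-- MNL lower-confidence consumption-rate gap bound (Lemma: difference between
the true consumption rate and its pessimistic estimate). -/
theorem stmt_1 {ι : Type*} (S : Finset ι) (v vLCB vUCB : ι → ℝ)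
    (hL0 : ∀ i ∈ S, 0 ≤ vLCB i)
    (hLv : ∀ i ∈ S, vLCB i ≤ v i)
    (hvU : ∀ i ∈ S, v i ≤ vUCB i)
    (hv1 : ∀ i ∈ S, v i ≤ 1) :
    ∀ i ∈ S,
      v i / (1 + ∑ j ∈ S, v j) - vLCB i / (1 + ∑ j ∈ S, vUCB j)
      ≤ (1 / (1 + ∑ j ∈ S, v j)) *
          ((v i - vLCB i) + ∑ j ∈ S, (vUCB j - v j)) := by
  intro i hi
  have hA : 0 ≤ ∑ j ∈ S, v j :=
    Finset.sum_nonneg fun j hj => (hL0 j hj).trans (hLv j hj)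
  have hAB : ∑ j ∈ S, v j ≤ ∑ j ∈ S, vUCB j := Finset.sum_le_sum hvU
  have hL : vLCB i ≤ 1 := (hLv i hi).trans (hv1 i hi)
  rw [Finset.sum_sub_distrib]
  generalize ∑ j ∈ S, v j = a at *
  generalize ∑ j ∈ S, vUCB j = b at *
  have hle : (vLCB i - (b - a)) / (1 + a) ≤ vLCB i / (1 + b) := by
    rw [div_le_div_iff₀ (by linarith) (by linarith)]
    nlinarith [mul_nonneg (sub_nonneg.2 hAB) (show 0 ≤ 1 + b - vLCB i by linarith)]
  calc
    v i / (1 + a) - vLCB i / (1 + b)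
        ≤ v i / (1 + a) - (vLCB i - (b - a)) / (1 + a) := by linarith
    _ = 1 / (1 + a) * (v i - vLCB i + (b - a)) := by ring
end

section
/- Let N, T, L be positive integers with L ≤ T, let S_1, …, S_L be subsets of {1,…,N}, and for each product i and epoch ℓ define T_i(ℓ) = #{τ ≤ ℓ : i ∈ S_τ} and T_i = T_i(L). Fix v_i ∈ [0,1] and constants C₁, C₂ ≥ 0, and suppose estimates v_{i,ℓ}^LCB ≤ v_i ≤ v_{i,ℓ}^UCB satisfy, for every ℓ with i ∈ S_ℓ, max{ v_{i,ℓ}^UCB − v_i , v_i − v_{i,ℓ}^LCB } ≤ C₁ √( v_i · log(√N·T⁴ + 1) / T_i(ℓ) ) + C₂ · log(√N·T⁴ + 1) / T_i(ℓ). Then there is a constant C depending only on C₁ and C₂ such that for every ℓ* ∈ {1,…,L} and every product i, both Σ_{ℓ=ℓ*}^L 1_{i∈S_ℓ} (v_{i,ℓ}^UCB − v_i) and Σ_{ℓ=ℓ*}^L 1_{i∈S_ℓ} (v_i − v_{i,ℓ}^LCB) are at most C · log(√N·T⁴ + 1)² · (1 + √(T_i · v_i)). -/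
open Finset in
/-- Summing a function of the running count of hits over the hits amounts to summing it over
`1, …, n`, where `n` is the total number of hits. -/
theorem sum_ite_card_filter_Icc (p : ℕ → Prop) [DecidablePred p] (f : ℕ → ℝ) (L : ℕ) :
    (∑ ℓ ∈ Icc 1 L, if p ℓ then f #{τ ∈ Icc 1 ℓ | p τ} else 0)
      = ∑ k ∈ Icc 1 #{τ ∈ Icc 1 L | p τ}, f k := by
  induction L with
  | zero => simp
  | succ m ih =>
    have hcard : #{τ ∈ Icc 1 (m + 1) | p τ} = #{τ ∈ Icc 1 m | p τ} + if p (m + 1) then 1 else 0 := by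
      rw [card_filter, card_filter, sum_Icc_succ_top (by omega)]
    rw [sum_Icc_succ_top (by omega), ih, hcard]
    split_ifs
    · rw [sum_Icc_succ_top (by omega)]
    · simp

theorem sum_Icc_inv_sqrt_le (n : ℕ) :
    ∑ k ∈ Finset.Icc 1 n, (Real.sqrt k)⁻¹ ≤ 2 * Real.sqrt n := by
  induction n with
  | zero => simp
  | succ m ih =>
    rw [Finset.sum_Icc_succ_top (by omega)]
    have hpos : 0 < Real.sqrt (m + 1 : ℕ) := Real.sqrt_pos.2 (by positivity)
    have hm := Real.sq_sqrt (Nat.cast_nonneg (α := ℝ) m)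
    have hm1 := Real.sq_sqrt (Nat.cast_nonneg (α := ℝ) (m + 1))
    have hstep : (Real.sqrt (m + 1 : ℕ))⁻¹
        ≤ 2 * Real.sqrt (m + 1 : ℕ) - 2 * Real.sqrt m := by
      rw [inv_le_iff_one_le_mul₀ hpos]
      push_cast at hm1 hm ⊢
      nlinarith [sq_nonneg (Real.sqrt ((m : ℝ) + 1) - Real.sqrt m)]
    linarith

theorem sum_Icc_inv_le_one_add_log (n : ℕ) :
    ∑ k ∈ Finset.Icc 1 n, (k : ℝ)⁻¹ ≤ 1 + Real.log n := by
  have h := harmonic_le_one_add_log n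
  rw [harmonic_eq_sum_Icc] at h
  push_cast at h
  exact h

open Finset in
/-- Confidence gaps at rate `C₁ √(w A / k) + C₂ A / k` at the `k`-th hit sum to
`O(A² (1 + √(n w)))` over `n` hits, provided `log n ≤ A` and `1 / 2 ≤ A`. -/
theorem sum_gap_le {C₁ C₂ A w : ℝ} (hC₁ : 0 ≤ C₁) (hC₂ : 0 ≤ C₂) (hA : 1 / 2 ≤ A) (hw : 0 ≤ w)
    (p : ℕ → Prop) [DecidablePred p] (g : ℕ → ℝ) {a L : ℕ} (ha : 1 ≤ a)
    (hlog : Real.log #{τ ∈ Icc 1 L | p τ} ≤ A)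
    (hg : ∀ ℓ ∈ Icc 1 L, p ℓ → g ℓ ≤ C₁ * Real.sqrt (w * A / (#{τ ∈ Icc 1 ℓ | p τ} : ℝ))
      + C₂ * (A / (#{τ ∈ Icc 1 ℓ | p τ} : ℝ))) :
    (∑ ℓ ∈ Icc a L, if p ℓ then g ℓ else 0)
      ≤ (8 * C₁ + 3 * C₂) * A ^ 2 * (1 + Real.sqrt ((#{τ ∈ Icc 1 L | p τ} : ℝ) * w)) := by
  set n := #{τ ∈ Icc 1 L | p τ}
  have hA0 : 0 ≤ A := by linarith
  let f : ℕ → ℝ := fun k => C₁ * Real.sqrt (w * A / k) + C₂ * (A / k)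
  have hf : ∀ k, 0 ≤ f k := fun k => by positivity
  have hsqrtA : Real.sqrt A ≤ 4 * A ^ 2 := by
    have hcube : (1 / 2 : ℝ) ^ 3 ≤ A ^ 3 := by gcongr
    refine Real.sqrt_le_iff.2 ⟨by positivity, ?_⟩
    nlinarith [mul_le_mul_of_nonneg_left hcube hA0]
  calc (∑ ℓ ∈ Icc a L, if p ℓ then g ℓ else 0)
      ≤ ∑ ℓ ∈ Icc a L, if p ℓ then f #{τ ∈ Icc 1 ℓ | p τ} else 0 := by
        refine sum_le_sum fun ℓ hℓ => ?_
        split_ifs with h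
        · exact hg ℓ (Icc_subset_Icc_left ha hℓ) h
        · exact le_rfl
    _ ≤ ∑ ℓ ∈ Icc 1 L, if p ℓ then f #{τ ∈ Icc 1 ℓ | p τ} else 0 := by
        refine sum_le_sum_of_subset_of_nonneg (Icc_subset_Icc_left ha) fun ℓ _ _ => ?_
        split_ifs
        · exact hf _
        · exact le_rfl
    _ = ∑ k ∈ Icc 1 n, f k := sum_ite_card_filter_Icc p f L
    _ = C₁ * (Real.sqrt w * Real.sqrt A) * ∑ k ∈ Icc 1 n, (Real.sqrt k)⁻¹
          + C₂ * A * ∑ k ∈ Icc 1 n, (k : ℝ)⁻¹ := by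
        rw [mul_sum, mul_sum, ← sum_add_distrib]
        refine sum_congr rfl fun k _ => ?_
        simp only [f]
        rw [Real.sqrt_div (mul_nonneg hw hA0), Real.sqrt_mul hw]
        ring
    _ ≤ C₁ * (Real.sqrt w * (4 * A ^ 2)) * (2 * Real.sqrt n) + C₂ * A * (1 + A) := by
        gcongr
        · exact sum_Icc_inv_sqrt_le n
        · exact (sum_Icc_inv_le_one_add_log n).trans (by linarith)
    _ ≤ (8 * C₁ + 3 * C₂) * A ^ 2 * (1 + Real.sqrt (n * w)) := by
        rw [Real.sqrt_mul (Nat.cast_nonneg n)]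
        have h₁ : 0 ≤ C₁ * A ^ 2 := by positivity
        have h₂ : 0 ≤ C₂ * A ^ 2 * (Real.sqrt n * Real.sqrt w) := by positivity
        have h₃ : C₂ * A * (1 + A) ≤ 3 * (C₂ * A ^ 2) := by
          nlinarith [mul_nonneg (mul_nonneg hC₂ hA0) (sub_nonneg.2 hA)]
        linarith

/-- Summed confidence-gap bound for a single product (first point of the
auxiliary lemma on the estimates `v^LCB, v^UCB`). -/
theorem stmt_2 (C₁ C₂ : ℝ) (hC₁ : 0 ≤ C₁) (hC₂ : 0 ≤ C₂) :
    ∃ C : ℝ, ∀ (N T L : ℕ), 0 < N → 0 < T → 0 < L → L ≤ T →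
    ∀ (S : ℕ → Finset (Fin N)) (v : Fin N → ℝ) (vLCB vUCB : Fin N → ℕ → ℝ),
    (∀ i, 0 ≤ v i ∧ v i ≤ 1) →
    (∀ i ℓ, vLCB i ℓ ≤ v i ∧ v i ≤ vUCB i ℓ) →
    (∀ (i : Fin N), ∀ ℓ ∈ Finset.Icc 1 L, i ∈ S ℓ →
      max (vUCB i ℓ - v i) (v i - vLCB i ℓ)
        ≤ C₁ * Real.sqrt (v i * Real.log (Real.sqrt N * (T : ℝ) ^ 4 + 1)
              / (((Finset.Icc 1 ℓ).filter (fun τ => i ∈ S τ)).card : ℝ))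
          + C₂ * (Real.log (Real.sqrt N * (T : ℝ) ^ 4 + 1)
              / (((Finset.Icc 1 ℓ).filter (fun τ => i ∈ S τ)).card : ℝ))) →
    ∀ ℓs ∈ Finset.Icc 1 L, ∀ i : Fin N,
      (∑ ℓ ∈ Finset.Icc ℓs L, if i ∈ S ℓ then vUCB i ℓ - v i else 0)
        ≤ C * Real.log (Real.sqrt N * (T : ℝ) ^ 4 + 1) ^ 2 *
            (1 + Real.sqrt ((((Finset.Icc 1 L).filter (fun τ => i ∈ S τ)).card : ℝ) * v i))
      ∧
      (∑ ℓ ∈ Finset.Icc ℓs L, if i ∈ S ℓ then v i - vLCB i ℓ else 0)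
        ≤ C * Real.log (Real.sqrt N * (T : ℝ) ^ 4 + 1) ^ 2 *
            (1 + Real.sqrt ((((Finset.Icc 1 L).filter (fun τ => i ∈ S τ)).card : ℝ) * v i)) := by
  refine ⟨8 * C₁ + 3 * C₂, fun N T L hN hT _ hLT S v vLCB vUCB hv _ hgap ℓs hℓs i => ?_⟩
  have hN1 : 1 ≤ Real.sqrt N := Real.one_le_sqrt.2 (by exact_mod_cast hN)
  have hT1 : (1 : ℝ) ≤ T := by exact_mod_cast hT
  have hNT : (T : ℝ) ≤ Real.sqrt N * (T : ℝ) ^ 4 :=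
    (le_self_pow₀ hT1 (by norm_num)).trans (le_mul_of_one_le_left (by positivity) hN1)
  have hA : 1 / 2 ≤ Real.log (Real.sqrt N * (T : ℝ) ^ 4 + 1) := by
    have h := Real.log_le_log (by norm_num) (show (2 : ℝ) ≤ Real.sqrt N * (T : ℝ) ^ 4 + 1 by linarith)
    linarith [Real.log_two_gt_d9]
  have hlog : Real.log ((Finset.Icc 1 L).filter (fun τ => i ∈ S τ)).card
      ≤ Real.log (Real.sqrt N * (T : ℝ) ^ 4 + 1) := by
    have hcard : ((Finset.Icc 1 L).filter (fun τ => i ∈ S τ)).card ≤ T :=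
      (Finset.card_filter_le _ _).trans (by simpa using hLT)
    rcases Nat.eq_zero_or_pos ((Finset.Icc 1 L).filter (fun τ => i ∈ S τ)).card with h0 | hpos
    · rw [h0, Nat.cast_zero, Real.log_zero]
      linarith
    · refine Real.log_le_log (by exact_mod_cast hpos) ?_
      linarith [show (((Finset.Icc 1 L).filter (fun τ => i ∈ S τ)).card : ℝ) ≤ T by
        exact_mod_cast hcard]
  have ha := (Finset.mem_Icc.1 hℓs).1
  exact ⟨sum_gap_le hC₁ hC₂ hA (hv i).1 (fun τ => i ∈ S τ) _ ha hlog
      fun ℓ hℓ h => (le_max_left _ _).trans (hgap i ℓ hℓ h),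
    sum_gap_le hC₁ hC₂ hA (hv i).1 (fun τ => i ∈ S τ) _ ha hlog
      fun ℓ hℓ h => (le_max_right _ _).trans (hgap i ℓ hℓ h)⟩
end

section
/- Define φ(i, S) = 1_{i∈S} · v_i/(1 + Σ_{j∈S} v_j) and φ_ℓ^LCB(i, S) = 1_{i∈S} · v_{i,ℓ}^LCB/(1 + Σ_{j∈S} v_{j,ℓ}^UCB), and V(S) = Σ_{i∈S} v_i. In the setting of the per-product confidence-gap bound (T_i(ℓ) = #{τ ≤ ℓ : i ∈ S_τ}, 0 ≤ v_{i,ℓ}^LCB ≤ v_i ≤ v_{i,ℓ}^UCB, v_i ≤ 1, gaps at most C₁√(v_i log(√N T⁴+1)/T_i(ℓ)) + C₂ log(√N T⁴+1)/T_i(ℓ) whenever i ∈ S_ℓ), with |S_ℓ| ≤ K for all ℓ, L ≤ T, and v_i ≤ v_max ≤ 1 for all i, there is a constant C depending only on C₁ and C₂ such that for every ℓ* ∈ {1,…,L} and every product i ∈ {1,…,N}: Σ_{ℓ=ℓ*}^L (V(S_ℓ) + 1) · | φ(i, S_ℓ) − φ_ℓ^LCB(i, S_ℓ) | ≤ 2C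 · log(√N·T⁴ + 1)² · ( N + √(K·N·T·v_max) ). -/
/-- Summing a function of the running count of occurrences over the occurrences themselves
amounts to summing it over `1, …, m`, with `m` the total count. -/
theorem sum_filter_running_count (P : ℕ → Prop) [DecidablePred P] (f : ℕ → ℝ) (L : ℕ) :
    ∑ ℓ ∈ (Finset.Icc 1 L).filter P, f ((Finset.Icc 1 ℓ).filter P).card
      = ∑ n ∈ Finset.Icc 1 ((Finset.Icc 1 L).filter P).card, f n := by
  induction L with
  | zero => simp
  | succ L ih =>
    have hIcc : Finset.Icc 1 (L + 1) = insert (L + 1) (Finset.Icc 1 L) :=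
      (Finset.insert_Icc_right_eq_Icc_add_one (by omega)).symm
    by_cases h : P (L + 1)
    · have hcard : ((Finset.Icc 1 (L + 1)).filter P).card
          = ((Finset.Icc 1 L).filter P).card + 1 := by
        rw [hIcc, Finset.filter_insert, if_pos h, Finset.card_insert_of_notMem (by simp)]
      rw [hcard, Finset.sum_Icc_succ_top (by omega), ← ih, hIcc, Finset.filter_insert, if_pos h,
        Finset.sum_insert (by simp), hcard, add_comm]
    · rw [hIcc, Finset.filter_insert, if_neg h, ih]

theorem sum_sqrt_div_le (c : ℝ) (hc : 0 ≤ c) (m : ℕ) :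
    ∑ n ∈ Finset.Icc 1 m, Real.sqrt (c / n) ≤ 2 * Real.sqrt (c * m) := by
  induction m with
  | zero => simp
  | succ m ih =>
    rw [Finset.sum_Icc_succ_top (by omega)]
    refine (add_le_add_left ih _).trans ?_
    rw [Real.sqrt_div hc, Real.sqrt_mul hc, Real.sqrt_mul hc]
    have hpos : 0 < Real.sqrt ((m + 1 : ℕ) : ℝ) := Real.sqrt_pos.2 (by positivity)
    have hb : Real.sqrt ((m + 1 : ℕ) : ℝ) ^ 2 = m + 1 := by
      rw [Real.sq_sqrt (by positivity)]; push_cast; ring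
    have ha : Real.sqrt (m : ℝ) ^ 2 = m := Real.sq_sqrt (by positivity)
    have hstep : 1 / Real.sqrt ((m + 1 : ℕ) : ℝ)
        ≤ 2 * Real.sqrt ((m + 1 : ℕ) : ℝ) - 2 * Real.sqrt (m : ℝ) := by
      rw [div_le_iff₀ hpos]
      nlinarith [sq_nonneg (Real.sqrt ((m + 1 : ℕ) : ℝ) - Real.sqrt (m : ℝ))]
    have := mul_le_mul_of_nonneg_left hstep (Real.sqrt_nonneg c)
    rw [mul_one_div] at this
    linarith

theorem sum_div_le_log (c : ℝ) (hc : 0 ≤ c) {m T : ℕ} (hm : m ≤ T) :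
    ∑ n ∈ Finset.Icc 1 m, c / (n : ℝ) ≤ c * (1 + Real.log T) := by
  have h1 : ∑ n ∈ Finset.Icc 1 m, c / (n : ℝ) ≤ ∑ n ∈ Finset.Icc 1 T, c / (n : ℝ) :=
    Finset.sum_le_sum_of_subset_of_nonneg (Finset.Icc_subset_Icc_right hm)
      fun _ _ _ => by positivity
  have h2 : ∑ n ∈ Finset.Icc 1 T, c / (n : ℝ) = c * ((harmonic T : ℚ) : ℝ) := by
    rw [harmonic_eq_sum_Icc]
    push_cast
    rw [Finset.mul_sum]
    exact Finset.sum_congr rfl fun _ _ => div_eq_mul_inv _ _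
  rw [h2] at h1
  exact h1.trans (mul_le_mul_of_nonneg_left (harmonic_le_one_add_log T) hc)

theorem weighted_ratio_gap_le {V D v a : ℝ} (hV : 0 ≤ V) (hD : 0 ≤ D) (ha : 0 ≤ a)
    (hav : a ≤ v) (hv : v ≤ 1) :
    (V + 1) * |v / (1 + V) - a / (1 + (V + D))| ≤ (v - a) + D := by
  have h1 : 0 < 1 + V := by linarith
  have h2 : 0 < 1 + (V + D) := by linarith
  have hle : a / (1 + (V + D)) ≤ v / (1 + V) :=
    div_le_div₀ (ha.trans hav) hav h1 (by linarith)
  rw [abs_of_nonneg (sub_nonneg.2 hle)]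
  have heq : (V + 1) * (v / (1 + V) - a / (1 + (V + D)))
      = (v - a) + a * (D / (1 + (V + D))) := by
    field_simp; ring
  have h3 : D / (1 + (V + D)) ≤ D := div_le_self hD (by linarith)
  have h4 : a * (D / (1 + (V + D))) ≤ 1 * D :=
    mul_le_mul (hav.trans hv) h3 (by positivity) zero_le_one
  linarith

/-- Total confidence width collected by all products over the epochs `1, …, L`. -/
theorem sum_confidence_width_le {N T L K : ℕ} (hLT : L ≤ T)
    {C₁ C₂ Λ vmax : ℝ} (hC₁ : 0 ≤ C₁) (hC₂ : 0 ≤ C₂) (hΛ : 0 ≤ Λ)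
    (S : ℕ → Finset (Fin N)) (v : Fin N → ℝ) (hS : ∀ ℓ, (S ℓ).card ≤ K)
    (hv : ∀ i, 0 ≤ v i ∧ v i ≤ vmax) (hvmax : 0 ≤ vmax) :
    ∑ ℓ ∈ Finset.Icc 1 L, ∑ j ∈ S ℓ,
        (C₁ * Real.sqrt (v j * Λ / (((Finset.Icc 1 ℓ).filter (fun τ => j ∈ S τ)).card : ℝ))
          + C₂ * (Λ / (((Finset.Icc 1 ℓ).filter (fun τ => j ∈ S τ)).card : ℝ)))
      ≤ 2 * C₁ * Real.sqrt Λ * Real.sqrt ((K : ℝ) * N * T * vmax)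
          + C₂ * Λ * (1 + Real.log T) * N := by
  set m : Fin N → ℕ := fun j => ((Finset.Icc 1 L).filter (fun τ => j ∈ S τ)).card with hm
  have hmL : ∀ j, m j ≤ T := fun j =>
    ((Finset.card_filter_le _ _).trans (by simp)).trans hLT
  have hswap : ∑ ℓ ∈ Finset.Icc 1 L, ∑ j ∈ S ℓ,
        (C₁ * Real.sqrt (v j * Λ / (((Finset.Icc 1 ℓ).filter (fun τ => j ∈ S τ)).card : ℝ))
          + C₂ * (Λ / (((Finset.Icc 1 ℓ).filter (fun τ => j ∈ S τ)).card : ℝ)))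
      = ∑ j, ∑ n ∈ Finset.Icc 1 (m j),
          (C₁ * Real.sqrt (v j * Λ / n) + C₂ * (Λ / n)) := by
    rw [Finset.sum_comm' (t' := Finset.univ)
      (s' := fun j => (Finset.Icc 1 L).filter (fun τ => j ∈ S τ)) (by simp)]
    exact Finset.sum_congr rfl fun j _ =>
      sum_filter_running_count (fun τ => j ∈ S τ)
        (fun n => C₁ * Real.sqrt (v j * Λ / n) + C₂ * (Λ / n)) L
  have hcount : ∑ j, (m j : ℝ) ≤ K * T := by
    have h : ∑ j, m j = ∑ ℓ ∈ Finset.Icc 1 L, (S ℓ).card := by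
      simp only [hm, Finset.card_eq_sum_ones]
      exact (Finset.sum_comm' (by simp)).symm
    have h' : ∑ ℓ ∈ Finset.Icc 1 L, (S ℓ).card ≤ K * T := by
      refine (Finset.sum_le_card_nsmul _ _ K fun ℓ _ => hS ℓ).trans ?_
      simp only [Nat.card_Icc, add_tsub_cancel_right, smul_eq_mul, mul_comm L]
      exact Nat.mul_le_mul_left K hLT
    exact_mod_cast h.le.trans h'
  have hcs : ∑ j, Real.sqrt (vmax * m j) ≤ Real.sqrt ((K : ℝ) * N * T * vmax) := by
    refine Real.le_sqrt_of_sq_le ?_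
    refine sq_sum_le_card_mul_sum_sq.trans ?_
    have h : ∑ j, Real.sqrt (vmax * m j) ^ 2 = vmax * ∑ j, (m j : ℝ) := by
      rw [Finset.mul_sum]
      exact Finset.sum_congr rfl fun j _ => Real.sq_sqrt (by positivity)
    rw [h, Finset.card_univ, Fintype.card_fin]
    have := mul_le_mul_of_nonneg_left hcount (mul_nonneg (Nat.cast_nonneg (α := ℝ) N) hvmax)
    linarith
  have hj : ∀ j, ∑ n ∈ Finset.Icc 1 (m j), (C₁ * Real.sqrt (v j * Λ / n) + C₂ * (Λ / n))
      ≤ 2 * C₁ * Real.sqrt Λ * Real.sqrt (vmax * m j) + C₂ * Λ * (1 + Real.log T) := by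
    intro j
    rw [Finset.sum_add_distrib, ← Finset.mul_sum, ← Finset.mul_sum]
    have h1 := sum_sqrt_div_le (v j * Λ) (mul_nonneg (hv j).1 hΛ) (m j)
    have h2 : Real.sqrt (v j * Λ * m j) ≤ Real.sqrt Λ * Real.sqrt (vmax * m j) := by
      rw [← Real.sqrt_mul hΛ]
      refine Real.sqrt_le_sqrt ?_
      have := mul_le_mul_of_nonneg_right (hv j).2 (mul_nonneg hΛ (Nat.cast_nonneg (α := ℝ) (m j)))
      linarith
    have h3 := mul_le_mul_of_nonneg_left
      (h1.trans (mul_le_mul_of_nonneg_left h2 zero_le_two)) hC₁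
    have h4 := mul_le_mul_of_nonneg_left (sum_div_le_log Λ hΛ (hmL j)) hC₂
    linarith
  rw [hswap]
  refine (Finset.sum_le_sum fun j _ => hj j).trans ?_
  rw [Finset.sum_add_distrib, ← Finset.mul_sum]
  have := mul_le_mul_of_nonneg_left hcs
    (by positivity : 0 ≤ 2 * C₁ * Real.sqrt Λ)
  simp only [Finset.sum_const, Finset.card_univ, Fintype.card_fin, nsmul_eq_mul]
  linarith

/-- Bound on the weighted deviation between the true MNL consumption rates and
their pessimistic (LCB) estimates (Lemma `phicb`). -/
theorem stmt_5 (C₁ C₂ : ℝ) (hC₁ : 0 ≤ C₁) (hC₂ : 0 ≤ C₂) :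
    ∃ C : ℝ, ∀ (N T L K : ℕ), 0 < N → 0 < T → 0 < L → 0 < K → L ≤ T →
    ∀ (S : ℕ → Finset (Fin N)) (v : Fin N → ℝ) (vLCB vUCB : Fin N → ℕ → ℝ) (vmax : ℝ),
    (∀ ℓ, (S ℓ).card ≤ K) →
    vmax ≤ 1 →
    (∀ i, 0 ≤ v i ∧ v i ≤ vmax) →
    (∀ i, v i ≤ 1) →
    (∀ i ℓ, 0 ≤ vLCB i ℓ ∧ vLCB i ℓ ≤ v i ∧ v i ≤ vUCB i ℓ) →
    (∀ (i : Fin N), ∀ ℓ ∈ Finset.Icc 1 L, i ∈ S ℓ →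
      max (vUCB i ℓ - v i) (v i - vLCB i ℓ)
        ≤ C₁ * Real.sqrt (v i * Real.log (Real.sqrt N * (T : ℝ) ^ 4 + 1)
              / (((Finset.Icc 1 ℓ).filter (fun τ => i ∈ S τ)).card : ℝ))
          + C₂ * (Real.log (Real.sqrt N * (T : ℝ) ^ 4 + 1)
              / (((Finset.Icc 1 ℓ).filter (fun τ => i ∈ S τ)).card : ℝ))) →
    ∀ ℓs ∈ Finset.Icc 1 L, ∀ i : Fin N,
      (∑ ℓ ∈ Finset.Icc ℓs L,
          ((∑ j ∈ S ℓ, v j) + 1) *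
            |(if i ∈ S ℓ then v i / (1 + ∑ j ∈ S ℓ, v j) else 0)
              - (if i ∈ S ℓ then vLCB i ℓ / (1 + ∑ j ∈ S ℓ, vUCB j ℓ) else 0)|)
        ≤ 2 * C * Real.log (Real.sqrt N * (T : ℝ) ^ 4 + 1) ^ 2 *
            ((N : ℝ) + Real.sqrt ((K : ℝ) * N * T * vmax)) := by
  refine ⟨8 * C₁ + 3 * C₂, ?_⟩
  intro N T L K hN hT _ _ hLT S v vLCB vUCB vmax hS _ hv hv1 hb hgap ℓs hℓs i
  have hvmax : 0 ≤ vmax := (hv i).1.trans (hv i).2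
  have hT1 : (1 : ℝ) ≤ T := by exact_mod_cast hT
  have hN1 : (1 : ℝ) ≤ Real.sqrt N := Real.one_le_sqrt.2 (by exact_mod_cast hN)
  have hT4 : (T : ℝ) ≤ Real.sqrt N * (T : ℝ) ^ 4 :=
    (le_self_pow₀ hT1 (by norm_num)).trans (le_mul_of_one_le_left (by positivity) hN1)
  set Λ := Real.log (Real.sqrt N * (T : ℝ) ^ 4 + 1)
  have hΛ : 1 / 2 ≤ Λ := by
    have h := Real.log_le_log zero_lt_two
      (by linarith : (2 : ℝ) ≤ Real.sqrt N * (T : ℝ) ^ 4 + 1)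
    linarith [Real.log_two_gt_d9]
  have hlogT : Real.log T ≤ Λ := Real.log_le_log (by linarith) (by linarith)
  have hΛ0 : 0 ≤ Λ := by linarith
  set g : Fin N → ℕ → ℝ := fun j ℓ =>
    C₁ * Real.sqrt (v j * Λ / (((Finset.Icc 1 ℓ).filter (fun τ => j ∈ S τ)).card : ℝ))
      + C₂ * (Λ / (((Finset.Icc 1 ℓ).filter (fun τ => j ∈ S τ)).card : ℝ))
  have hg : ∀ j ℓ, 0 ≤ g j ℓ := fun j ℓ => by positivity
  have hterm : ∀ ℓ ∈ Finset.Icc 1 L, ((∑ j ∈ S ℓ, v j) + 1) *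
      |(if i ∈ S ℓ then v i / (1 + ∑ j ∈ S ℓ, v j) else 0)
        - (if i ∈ S ℓ then vLCB i ℓ / (1 + ∑ j ∈ S ℓ, vUCB j ℓ) else 0)|
      ≤ 2 * ∑ j ∈ S ℓ, g j ℓ := by
    intro ℓ hℓ
    by_cases hi : i ∈ S ℓ
    · have hU : ∑ j ∈ S ℓ, vUCB j ℓ = ∑ j ∈ S ℓ, v j + ∑ j ∈ S ℓ, (vUCB j ℓ - v j) := by
        rw [Finset.sum_sub_distrib]; ring
      have hD : ∑ j ∈ S ℓ, (vUCB j ℓ - v j) ≤ ∑ j ∈ S ℓ, g j ℓ :=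
        Finset.sum_le_sum fun j hj => (le_max_left _ _).trans (hgap j ℓ hℓ hj)
      have hL : v i - vLCB i ℓ ≤ ∑ j ∈ S ℓ, g j ℓ :=
        ((le_max_right _ _).trans (hgap i ℓ hℓ hi)).trans
          (Finset.single_le_sum (f := fun j => g j ℓ) (fun j _ => hg j ℓ) hi)
      rw [if_pos hi, if_pos hi, hU]
      have := weighted_ratio_gap_le (Finset.sum_nonneg fun j (_ : j ∈ S ℓ) => (hv j).1)
        (Finset.sum_nonneg fun j (_ : j ∈ S ℓ) => sub_nonneg.2 (hb j ℓ).2.2)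
        (hb i ℓ).1 (hb i ℓ).2.1 (hv1 i)
      linarith
    · rw [if_neg hi, if_neg hi, sub_zero, abs_zero, mul_zero]
      exact mul_nonneg zero_le_two (Finset.sum_nonneg fun j _ => hg j ℓ)
  have hsub : Finset.Icc ℓs L ⊆ Finset.Icc 1 L :=
    Finset.Icc_subset_Icc_left (Finset.mem_Icc.1 hℓs).1
  have hwidth := sum_confidence_width_le hLT hC₁ hC₂ hΛ0 S v hS hv hvmax
  have hsqrt : Real.sqrt Λ ≤ 4 * Λ ^ 2 :=
    Real.sqrt_le_iff.2 ⟨by positivity, by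
      have h1 : 1 ≤ 2 * Λ := by linarith
      have h2 : 1 ≤ (2 * Λ) ^ 3 := one_le_pow₀ h1
      nlinarith⟩
  set R := Real.sqrt ((K : ℝ) * N * T * vmax)
  have hR : 0 ≤ R := Real.sqrt_nonneg _
  have h1 : 2 * C₁ * Real.sqrt Λ * R ≤ 2 * C₁ * (4 * Λ ^ 2) * R := by gcongr
  have h2 : C₂ * Λ * (1 + Real.log T) * N ≤ C₂ * Λ * (3 * Λ) * N := by
    gcongr; linarith
  have h3 : 0 ≤ C₁ * Λ ^ 2 * N := by positivity
  have h4 : 0 ≤ C₂ * Λ ^ 2 * R := by positivity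
  calc _ ≤ ∑ ℓ ∈ Finset.Icc ℓs L, 2 * ∑ j ∈ S ℓ, g j ℓ :=
        Finset.sum_le_sum fun ℓ hℓ => hterm ℓ (hsub hℓ)
    _ ≤ ∑ ℓ ∈ Finset.Icc 1 L, 2 * ∑ j ∈ S ℓ, g j ℓ :=
        Finset.sum_le_sum_of_subset_of_nonneg hsub fun ℓ _ _ =>
          mul_nonneg zero_le_two (Finset.sum_nonneg fun j _ => hg j ℓ)
    _ = 2 * ∑ ℓ ∈ Finset.Icc 1 L, ∑ j ∈ S ℓ, g j ℓ := (Finset.mul_sum _ _ _).symm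
    _ ≤ _ := by linarith
end

section
/- Let 𝒮 be a finite family of assortments containing the empty assortment ∅. For each S ∈ 𝒮 and each product i ∈ {1,…,N}, let reals satisfy 0 ≤ p_i^LCB(S) ≤ p_i(S) ≤ p_i^UCB(S), with p_i(∅) = 0 and p_i^LCB(∅) = 0. Let r_i ≥ 0, R(S) = Σ_i r_i p_i(S), R^UCB(S) = Σ_i r_i p_i^UCB(S), let ω ∈ [0,1] and b_i ≥ 0. Suppose y* is a probability vector on 𝒮 with Σ_S y*(S) p_i(S) ≤ b_i for all i. Then the vector ỹ = (1−ω) y* + ω δ_∅ is a probability vector on 𝒮 satisfying Σ_S ỹ(S) p_i^LCB(S) ≤ (1−ω) b_i for all i, and Σ_S ỹ(S) R^UCB(S) ≥ (1−ω) Σ_S y*(S) R(S). Consequently, the maximum of Σ_S y(S) R^UCB(S) over probability vectors y with Σ_S y(S) p_i^LCB(S) ≤ (1−ω) b_i for all i is at least (1−ω) times the maximum of Σ_S y(S) R(S) over probability vectors y with Σ_S y(S) p_i(S) ≤ b_i for all i. -/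
/-- Summing against the mixture of `y` with a point mass at `a`. -/
theorem Finset.sum_mix_pointMass_mul {α : Type*} [DecidableEq α] {s : Finset α} {a : α}
    (ha : a ∈ s) (ω : ℝ) (y f : α → ℝ) :
    ∑ x ∈ s, ((1 - ω) * y x + ω * (if x = a then 1 else 0)) * f x
      = (1 - ω) * ∑ x ∈ s, y x * f x + ω * f a := by
  simp [add_mul, Finset.sum_add_distrib, Finset.mul_sum, mul_assoc, ha]

/-- Shrinking an optimal solution of the true LP yields a feasible solution of
the optimistic shrunk LP losing at most a factor `(1 - ω)`; consequently the
optimistic shrunk LP value is at least `(1 - ω)` times the true LP value. -/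
theorem stmt_7 {N : ℕ} (𝒮 : Finset (Finset (Fin N))) (hempty : ∅ ∈ 𝒮)
    (p pLCB pUCB : Fin N → Finset (Fin N) → ℝ) (r : Fin N → ℝ)
    (ω : ℝ) (b : Fin N → ℝ) (ystar : Finset (Fin N) → ℝ)
    (hpL0 : ∀ i, ∀ S ∈ 𝒮, 0 ≤ pLCB i S)
    (hpLp : ∀ i, ∀ S ∈ 𝒮, pLCB i S ≤ p i S)
    (hppU : ∀ i, ∀ S ∈ 𝒮, p i S ≤ pUCB i S)
    (hpe : ∀ i, p i ∅ = 0) (hpLe : ∀ i, pLCB i ∅ = 0)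
    (hr : ∀ i, 0 ≤ r i)
    (hω0 : 0 ≤ ω) (hω1 : ω ≤ 1) (hb : ∀ i, 0 ≤ b i)
    (hy0 : ∀ S ∈ 𝒮, 0 ≤ ystar S) (hy1 : ∑ S ∈ 𝒮, ystar S = 1)
    (hyfeas : ∀ i, ∑ S ∈ 𝒮, ystar S * p i S ≤ b i) :
    (∀ S ∈ 𝒮, 0 ≤ (1 - ω) * ystar S + ω * (if S = ∅ then 1 else 0))
    ∧ (∑ S ∈ 𝒮, ((1 - ω) * ystar S + ω * (if S = ∅ then 1 else 0)) = 1)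
    ∧ (∀ i, ∑ S ∈ 𝒮, ((1 - ω) * ystar S + ω * (if S = ∅ then 1 else 0)) * pLCB i S
          ≤ (1 - ω) * b i)
    ∧ (∑ S ∈ 𝒮, ((1 - ω) * ystar S + ω * (if S = ∅ then 1 else 0)) *
          (∑ i, r i * pUCB i S)
        ≥ (1 - ω) * ∑ S ∈ 𝒮, ystar S * (∑ i, r i * p i S))
    ∧ (sSup {x : ℝ | ∃ y : Finset (Fin N) → ℝ,
            (∀ S ∈ 𝒮, 0 ≤ y S) ∧ (∑ S ∈ 𝒮, y S = 1) ∧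
            (∀ i, ∑ S ∈ 𝒮, y S * pLCB i S ≤ (1 - ω) * b i) ∧
            x = ∑ S ∈ 𝒮, y S * (∑ i, r i * pUCB i S)}
        ≥ (1 - ω) * sSup {x : ℝ | ∃ y : Finset (Fin N) → ℝ,
            (∀ S ∈ 𝒮, 0 ≤ y S) ∧ (∑ S ∈ 𝒮, y S = 1) ∧
            (∀ i, ∑ S ∈ 𝒮, y S * p i S ≤ b i) ∧
            x = ∑ S ∈ 𝒮, y S * (∑ i, r i * p i S)}) := by
  have mix_nonneg (y : Finset (Fin N) → ℝ) (hy : ∀ S ∈ 𝒮, 0 ≤ y S) :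
      ∀ S ∈ 𝒮, 0 ≤ (1 - ω) * y S + ω * (if S = ∅ then 1 else 0) := fun S hS =>
    add_nonneg (mul_nonneg (sub_nonneg.2 hω1) (hy S hS))
      (mul_nonneg hω0 (by split_ifs <;> norm_num))
  have mix_sum (y : Finset (Fin N) → ℝ) (hy : ∑ S ∈ 𝒮, y S = 1) :
      ∑ S ∈ 𝒮, ((1 - ω) * y S + ω * (if S = ∅ then 1 else 0)) = 1 := by
    simpa [hy] using Finset.sum_mix_pointMass_mul hempty ω y fun _ => 1
  have mix_feasible (y : Finset (Fin N) → ℝ) (hy : ∀ S ∈ 𝒮, 0 ≤ y S)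
      (hyb : ∀ i, ∑ S ∈ 𝒮, y S * p i S ≤ b i) (i : Fin N) :
      ∑ S ∈ 𝒮, ((1 - ω) * y S + ω * (if S = ∅ then 1 else 0)) * pLCB i S
        ≤ (1 - ω) * b i := by
    rw [Finset.sum_mix_pointMass_mul hempty, hpLe, mul_zero, add_zero]
    refine mul_le_mul_of_nonneg_left (le_trans ?_ (hyb i)) (sub_nonneg.2 hω1)
    exact Finset.sum_le_sum fun S hS => mul_le_mul_of_nonneg_left (hpLp i S hS) (hy S hS)
  have revenue_nonneg (S : Finset (Fin N)) (hS : S ∈ 𝒮) : 0 ≤ ∑ i, r i * pUCB i S :=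
    Finset.sum_nonneg fun i _ =>
      mul_nonneg (hr i) ((hpL0 i S hS).trans ((hpLp i S hS).trans (hppU i S hS)))
  have mix_revenue (y : Finset (Fin N) → ℝ) (hy : ∀ S ∈ 𝒮, 0 ≤ y S) :
      (1 - ω) * ∑ S ∈ 𝒮, y S * (∑ i, r i * p i S)
        ≤ ∑ S ∈ 𝒮, ((1 - ω) * y S + ω * (if S = ∅ then 1 else 0)) *
          (∑ i, r i * pUCB i S) := by
    rw [Finset.sum_mix_pointMass_mul hempty ω y fun S => ∑ i, r i * pUCB i S]
    refine le_add_of_le_of_nonneg (mul_le_mul_of_nonneg_left ?_ (sub_nonneg.2 hω1))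
      (mul_nonneg hω0 (revenue_nonneg ∅ hempty))
    exact Finset.sum_le_sum fun S hS => mul_le_mul_of_nonneg_left
      (Finset.sum_le_sum fun i _ => mul_le_mul_of_nonneg_left (hppU i S hS) (hr i)) (hy S hS)
  refine ⟨mix_nonneg ystar hy0, mix_sum ystar hy1, mix_feasible ystar hy0 hyfeas,
    mix_revenue ystar hy0, ?_⟩
  rw [ge_iff_le, ← smul_eq_mul, ← Real.sSup_smul_of_nonneg (sub_nonneg.2 hω1)]
  refine csSup_le (Set.Nonempty.smul_set ⟨_, ystar, hy0, hy1, hyfeas, rfl⟩) ?_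
  rintro _ ⟨_, ⟨y, hy, hys, hyb, rfl⟩, rfl⟩
  refine (mix_revenue y hy).trans (le_csSup ⟨∑ S ∈ 𝒮, ∑ i, r i * pUCB i S, ?_⟩
    ⟨_, mix_nonneg y hy, mix_sum y hys, mix_feasible y hy hyb, rfl⟩)
  rintro _ ⟨z, hz, hzs, -, rfl⟩
  exact Finset.sum_le_sum fun S hS => mul_le_of_le_one_left (revenue_nonneg S hS)
    (hzs ▸ Finset.single_le_sum hz hS)
end

section
/- Let 𝒮 be a finite family of assortments containing ∅, let r_i ≥ 0, ω ∈ [0,1], ε ≥ 0, b_i ≥ 0, T > 0 and 0 ≤ t* ≤ T. For each epoch ℓ ∈ {ℓ*,…,L}, let reals satisfy 0 ≤ p_{i,ℓ}^LCB(S) ≤ p_i(S) ≤ p_{i,ℓ}^UCB(S) with p_i(∅) = 0 and p_{i,ℓ}^LCB(∅) = 0, set R_ℓ^UCB(S) = Σ_i r_i p_{i,ℓ}^UCB(S), and suppose the probability vector y_ℓ on 𝒮 satisfies Σ_S y_ℓ(S) p_{i,ℓ}^LCB(S) ≤ (1−ω) b_i for all i and Σ_S y_ℓ(S) R_ℓ^UCB(S)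 ≥ (1/(1+ε)) · max{ Σ_S y(S) R_ℓ^UCB(S) : y a probability vector on 𝒮 with Σ_S y(S) p_{i,ℓ}^LCB(S) ≤ (1−ω) b_i for all i }. Suppose further there is a probability vector y* on 𝒮 with Σ_S y*(S) p_i(S) ≤ b_i for all i and Σ_S y*(S) Σ_i r_i p_i(S) = OPT/T. Then for any nonnegative reals E_{ℓ*},…,E_L with Σ_{ℓ=ℓ*}^L E_ℓ = T − t*, one has Σ_{ℓ=ℓ*}^L E_ℓ · Σ_S y_ℓ(S) R_ℓ^UCB(S) ≥ (1−ω)(T − t*)/((1+ε)T) · OPT. -/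
/-- Averages under the mixture of `y` (weight `1 - ω`) and the point mass at `a` (weight `ω`). -/
theorem sum_mix_pointMass {α : Type*} [DecidableEq α] {s : Finset α} {a : α} (ha : a ∈ s)
    (ω : ℝ) (y f : α → ℝ) :
    ∑ x ∈ s, ((1 - ω) * y x + if x = a then ω else 0) * f x
      = (1 - ω) * ∑ x ∈ s, y x * f x + ω * f a := by
  simp [add_mul, Finset.sum_add_distrib, Finset.mul_sum, mul_assoc, ha]

/-- An average under a probability vector is bounded by the sum of absolute values. -/
theorem sum_mul_le_sum_abs {α : Type*} {s : Finset α} {z : α → ℝ} (f : α → ℝ)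
    (hz0 : ∀ x ∈ s, 0 ≤ z x) (hz1 : ∑ x ∈ s, z x = 1) :
    ∑ x ∈ s, z x * f x ≤ ∑ x ∈ s, |f x| := by
  refine Finset.sum_le_sum fun x hx => ?_
  have hzx : z x ≤ 1 := hz1 ▸ Finset.single_le_sum hz0 hx
  calc z x * f x ≤ z x * |f x| := mul_le_mul_of_nonneg_left (le_abs_self _) (hz0 x hx)
    _ ≤ |f x| := mul_le_of_le_one_left (abs_nonneg _) hzx

/-- Lower bound on the total optimistic revenue collected by the approximately
optimal distributions `y_ℓ` over the epochs (Lemma on the lower bound of the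
optimistic revenue term). -/
theorem stmt_8 {N : ℕ} (𝒮 : Finset (Finset (Fin N))) (hempty : ∅ ∈ 𝒮)
    (r : Fin N → ℝ) (ω ε T tstar OPT : ℝ) (b : Fin N → ℝ) (ℓs L : ℕ)
    (p : Fin N → Finset (Fin N) → ℝ)
    (pLCB pUCB : ℕ → Fin N → Finset (Fin N) → ℝ)
    (y : ℕ → Finset (Fin N) → ℝ) (ystar : Finset (Fin N) → ℝ) (E : ℕ → ℝ)
    (hr : ∀ i, 0 ≤ r i)
    (hω0 : 0 ≤ ω) (hω1 : ω ≤ 1) (hε : 0 ≤ ε) (hb : ∀ i, 0 ≤ b i)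
    (hT : 0 < T) (ht0 : 0 ≤ tstar) (htT : tstar ≤ T)
    (hpL0 : ∀ ℓ ∈ Finset.Icc ℓs L, ∀ i, ∀ S ∈ 𝒮, 0 ≤ pLCB ℓ i S)
    (hpLp : ∀ ℓ ∈ Finset.Icc ℓs L, ∀ i, ∀ S ∈ 𝒮, pLCB ℓ i S ≤ p i S)
    (hppU : ∀ ℓ ∈ Finset.Icc ℓs L, ∀ i, ∀ S ∈ 𝒮, p i S ≤ pUCB ℓ i S)
    (hpe : ∀ i, p i ∅ = 0)
    (hpLe : ∀ ℓ ∈ Finset.Icc ℓs L, ∀ i, pLCB ℓ i ∅ = 0)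
    (hy0 : ∀ ℓ ∈ Finset.Icc ℓs L, ∀ S ∈ 𝒮, 0 ≤ y ℓ S)
    (hy1 : ∀ ℓ ∈ Finset.Icc ℓs L, ∑ S ∈ 𝒮, y ℓ S = 1)
    (hyfeas : ∀ ℓ ∈ Finset.Icc ℓs L, ∀ i,
        ∑ S ∈ 𝒮, y ℓ S * pLCB ℓ i S ≤ (1 - ω) * b i)
    (hyapx : ∀ ℓ ∈ Finset.Icc ℓs L,
        ∑ S ∈ 𝒮, y ℓ S * (∑ i, r i * pUCB ℓ i S)
          ≥ (1 / (1 + ε)) * sSup {x : ℝ | ∃ z : Finset (Fin N) → ℝ,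
              (∀ S ∈ 𝒮, 0 ≤ z S) ∧ (∑ S ∈ 𝒮, z S = 1) ∧
              (∀ i, ∑ S ∈ 𝒮, z S * pLCB ℓ i S ≤ (1 - ω) * b i) ∧
              x = ∑ S ∈ 𝒮, z S * (∑ i, r i * pUCB ℓ i S)})
    (hystar0 : ∀ S ∈ 𝒮, 0 ≤ ystar S) (hystar1 : ∑ S ∈ 𝒮, ystar S = 1)
    (hystarfeas : ∀ i, ∑ S ∈ 𝒮, ystar S * p i S ≤ b i)
    (hystarval : ∑ S ∈ 𝒮, ystar S * (∑ i, r i * p i S) = OPT / T)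
    (hE : ∀ ℓ ∈ Finset.Icc ℓs L, 0 ≤ E ℓ)
    (hEsum : ∑ ℓ ∈ Finset.Icc ℓs L, E ℓ = T - tstar) :
    ∑ ℓ ∈ Finset.Icc ℓs L, E ℓ * ∑ S ∈ 𝒮, y ℓ S * (∑ i, r i * pUCB ℓ i S)
      ≥ (1 - ω) * (T - tstar) / ((1 + ε) * T) * OPT := by
  have hepoch : ∀ ℓ ∈ Finset.Icc ℓs L,
      (1 / (1 + ε)) * ((1 - ω) * (OPT / T))
        ≤ ∑ S ∈ 𝒮, y ℓ S * (∑ i, r i * pUCB ℓ i S) := by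
    intro ℓ hℓ
    refine le_trans (mul_le_mul_of_nonneg_left ?_ (by positivity)) (hyapx ℓ hℓ)
    have hω1' : 0 ≤ 1 - ω := sub_nonneg.2 hω1
    have hrev : ∀ S ∈ 𝒮, ∑ i, r i * p i S ≤ ∑ i, r i * pUCB ℓ i S := fun S hS =>
      Finset.sum_le_sum fun i _ => mul_le_mul_of_nonneg_left (hppU ℓ hℓ i S hS) (hr i)
    have hrev0 : 0 ≤ ∑ i, r i * pUCB ℓ i ∅ := by
      simpa [hpe] using hrev ∅ hempty
    have hval : (1 - ω) * (OPT / T) ≤ ∑ S ∈ 𝒮,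
        ((1 - ω) * ystar S + if S = ∅ then ω else 0) * (∑ i, r i * pUCB ℓ i S) := by
      rw [sum_mix_pointMass hempty, ← hystarval]
      refine le_add_of_le_of_nonneg (mul_le_mul_of_nonneg_left ?_ hω1') (mul_nonneg hω0 hrev0)
      exact Finset.sum_le_sum fun S hS => mul_le_mul_of_nonneg_left (hrev S hS) (hystar0 S hS)
    refine hval.trans (le_csSup ?_ ⟨_, ?_, ?_, ?_, rfl⟩)
    · refine ⟨∑ S ∈ 𝒮, |∑ i, r i * pUCB ℓ i S|, ?_⟩
      rintro x ⟨z, hz0, hz1, -, rfl⟩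
      exact sum_mul_le_sum_abs _ hz0 hz1
    · intro S hS
      refine add_nonneg (mul_nonneg hω1' (hystar0 S hS)) ?_
      split_ifs
      exacts [hω0, le_rfl]
    · simpa [hystar1] using sum_mix_pointMass hempty ω ystar (fun _ => 1)
    · intro i
      rw [sum_mix_pointMass hempty, hpLe ℓ hℓ i, mul_zero, add_zero]
      refine mul_le_mul_of_nonneg_left (le_trans ?_ (hystarfeas i)) hω1'
      exact Finset.sum_le_sum fun S hS =>
        mul_le_mul_of_nonneg_left (hpLp ℓ hℓ i S hS) (hystar0 S hS)
  calc (1 - ω) * (T - tstar) / ((1 + ε) * T) * OPT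
      = ∑ ℓ ∈ Finset.Icc ℓs L, E ℓ * ((1 / (1 + ε)) * ((1 - ω) * (OPT / T))) := by
        rw [← Finset.sum_mul, hEsum]
        field_simp
    _ ≤ _ := Finset.sum_le_sum fun ℓ hℓ => mul_le_mul_of_nonneg_left (hepoch ℓ hℓ) (hE ℓ hℓ)
end

section
/- Fix N, T, K positive integers, weights v_i ≥ 0, prices r_i ≥ 0 with r_0 = 0, and inventories q_i ≥ 0. Let 𝒮 be the family of subsets of {1,…,N} of size at most K and define p_i(S) = 1_{i∈S} v_i/(1 + Σ_{j∈S} v_j) and R(S) = Σ_{i∈S} r_i p_i(S). On a probability space, let (S_t)_{t=1}^T be 𝒮-valued and (c_t)_{t=1}^T be {0,1,…,N}-valued random variables such that for every t and every i ∈ {1,…,N}, the conditional probability that c_t = i given the history σ(S_1, c_1, …, S_{t−1}, c_{t−1}, S_t) equals p_i(S_t) almost surely, and such that almost surely Σ_{t=1}^T 1_{c_t = i} ≤ q_i for every i. Then E[ Σ_{t=1}^T r_{c_t} ] ≤ T · sup{ Σ_{S∈𝒮} y_S R(S) : y a probability distribution on 𝒮 with Σ_{S∈𝒮} y_S p_i(S)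 ≤ q_i/T for all i }. -/
open MeasureTheory Filter

/-- MNL purchase probability of product `i` under assortment `A`. -/
noncomputable def mnlProb (v : ℕ → ℝ) (i : ℕ) (A : Finset ℕ) : ℝ :=
  if i ∈ A then v i / (1 + ∑ j ∈ A, v j) else 0

/-- MNL expected revenue of assortment `A`. -/
noncomputable def mnlRev (v r : ℕ → ℝ) (A : Finset ℕ) : ℝ :=
  ∑ i ∈ A, r i * mnlProb v i A

open Classical in
/-- The expectation of a function of a random element with finitely many values. -/
theorem integral_comp_eq_sum_of_mem_finset {Ω α : Type*} [MeasurableSpace Ω] (μ : Measure Ω)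
    [IsFiniteMeasure μ] (f : Ω → α) (hf : ∀ a, MeasurableSet (f ⁻¹' {a})) (F : Finset α)
    (hF : ∀ ω, f ω ∈ F) (g : α → ℝ) :
    ∫ ω, g (f ω) ∂μ = ∑ a ∈ F, μ.real (f ⁻¹' {a}) * g a := by
  have h : ∀ ω, g (f ω) = ∑ a ∈ F, (f ⁻¹' {a}).indicator (fun _ => g a) ω := by
    intro ω
    simp [Set.indicator_apply, hF ω]
  simp_rw [h]
  rw [integral_finsetSum _ fun a _ => (integrable_const (g a)).indicator (hf a)]
  exact Finset.sum_congr rfl fun a _ => by simp [integral_indicator_const _ (hf a)]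

theorem mnlRev_eq_sum_of_subset (v r : ℕ → ℝ) {A B : Finset ℕ} (h : A ⊆ B) :
    mnlRev v r A = ∑ i ∈ B, r i * mnlProb v i A :=
  Finset.sum_subset h fun i _ hi => by simp [mnlProb, hi]

/-- A function on a finite set is bounded in average, uniformly over probability weights. -/
theorem sum_mul_le_sum_abs_s9 {α : Type*} (F : Finset α) (y g : α → ℝ) (hy : ∀ a ∈ F, 0 ≤ y a)
    (hy1 : ∑ a ∈ F, y a = 1) : ∑ a ∈ F, y a * g a ≤ ∑ a ∈ F, |g a| := by
  refine Finset.sum_le_sum fun a ha => ?_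
  have h1 : y a ≤ 1 := hy1 ▸ Finset.single_le_sum hy ha
  nlinarith [le_abs_self (g a), abs_nonneg (g a), hy a ha]

/-- The expected revenue of any non-anticipative policy respecting the hard
inventory constraints is at most `T · OPT^LP` (Lemma `OPT-LP`). -/
theorem stmt_9 {Ω : Type*} [MeasurableSpace Ω] (μ : Measure Ω) [IsProbabilityMeasure μ]
    (N T K : ℕ) (hN : 0 < N) (hT : 0 < T) (hK : 0 < K)
    (v r q : ℕ → ℝ) (hv : ∀ i, 0 ≤ v i) (hr : ∀ i, 0 ≤ r i) (hr0 : r 0 = 0)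
    (hq : ∀ i, 0 ≤ q i)
    (S : ℕ → Ω → Finset ℕ) (c : ℕ → Ω → ℕ)
    (hSmeas : ∀ t, MeasurableSpace.comap (S t) ⊤ ≤ (inferInstance : MeasurableSpace Ω))
    (hcmeas : ∀ t, Measurable (c t))
    (hSval : ∀ t ω, S t ω ⊆ Finset.Icc 1 N ∧ (S t ω).card ≤ K)
    (hcval : ∀ t ω, c t ω ≤ N)
    (hcond : ∀ t ∈ Finset.Icc 1 T, ∀ i ∈ Finset.Icc 1 N,
      μ[(fun ω => if c t ω = i then (1 : ℝ) else 0) |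
          (⨆ s ∈ Finset.Icc 1 (t - 1),
            (MeasurableSpace.comap (S s) ⊤ ⊔ MeasurableSpace.comap (c s) ⊤))
          ⊔ MeasurableSpace.comap (S t) ⊤]
        =ᵐ[μ] fun ω => mnlProb v i (S t ω))
    (hinv : ∀ᵐ ω ∂μ, ∀ i ∈ Finset.Icc 1 N,
      (∑ t ∈ Finset.Icc 1 T, if c t ω = i then (1 : ℝ) else 0) ≤ q i) :
    (∫ ω, ∑ t ∈ Finset.Icc 1 T, r (c t ω) ∂μ)
      ≤ T * sSup {x : ℝ | ∃ y : Finset ℕ → ℝ,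
          (∀ A ∈ (Finset.Icc 1 N).powerset.filter (fun A => A.card ≤ K), 0 ≤ y A) ∧
          (∑ A ∈ (Finset.Icc 1 N).powerset.filter (fun A => A.card ≤ K), y A = 1) ∧
          (∀ i ∈ Finset.Icc 1 N,
            ∑ A ∈ (Finset.Icc 1 N).powerset.filter (fun A => A.card ≤ K),
              y A * mnlProb v i A ≤ q i / T) ∧
          x = ∑ A ∈ (Finset.Icc 1 N).powerset.filter (fun A => A.card ≤ K),
              y A * mnlRev v r A} := by
  set F := (Finset.Icc 1 N).powerset.filter (fun A => A.card ≤ K) with hFdef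
  have hTpos : (0 : ℝ) < T := by exact_mod_cast hT
  have hSF : ∀ t ω, S t ω ∈ F := fun t ω => by simp [hFdef, hSval t ω]
  have hSset : ∀ t A, MeasurableSet (S t ⁻¹' {A}) := fun t A => hSmeas t _ ⟨{A}, trivial, rfl⟩
  have hcset : ∀ t i, MeasurableSet (c t ⁻¹' {i}) := fun t i =>
    hcmeas t (measurableSet_singleton i)
  have hexp : ∀ t (g : Finset ℕ → ℝ), ∫ ω, g (S t ω) ∂μ = ∑ A ∈ F, μ.real (S t ⁻¹' {A}) * g A :=
    fun t g => integral_comp_eq_sum_of_mem_finset μ (S t) (hSset t) F (hSF t) g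
  have hind : ∀ t i, (fun ω => if c t ω = i then (1 : ℝ) else 0)
      = (c t ⁻¹' {i}).indicator (fun _ => (1 : ℝ)) := fun t i => by
    funext ω
    by_cases h : c t ω = i <;> simp [h]
  have hint : ∀ t i, Integrable (fun ω => if c t ω = i then (1 : ℝ) else 0) μ := fun t i => by
    rw [hind]
    exact (integrable_const _).indicator (hcset t i)
  have hbuy : ∀ t ∈ Finset.Icc 1 T, ∀ i ∈ Finset.Icc 1 N,
      ∫ ω, (if c t ω = i then (1 : ℝ) else 0) ∂μ
        = ∑ A ∈ F, μ.real (S t ⁻¹' {A}) * mnlProb v i A := by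
    intro t ht i hi
    rw [← hexp t (mnlProb v i), ← integral_congr_ae (hcond t ht i hi), integral_condExp]
    refine sup_le (iSup₂_le fun s _ => sup_le (hSmeas s) ?_) (hSmeas t)
    exact (hcmeas s).comap_le
  set y : Finset ℕ → ℝ := fun A => (∑ t ∈ Finset.Icc 1 T, μ.real (S t ⁻¹' {A})) / T with hydef
  have havg : ∀ g : Finset ℕ → ℝ, ∑ A ∈ F, y A * g A
      = (∑ t ∈ Finset.Icc 1 T, ∑ A ∈ F, μ.real (S t ⁻¹' {A}) * g A) / T := by
    intro g
    rw [Finset.sum_comm, Finset.sum_div]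
    refine Finset.sum_congr rfl fun A _ => ?_
    rw [← Finset.sum_mul, div_mul_eq_mul_div]
  have hrev : ∫ ω, ∑ t ∈ Finset.Icc 1 T, r (c t ω) ∂μ = T * ∑ A ∈ F, y A * mnlRev v r A := by
    have hpt : ∀ t ω, r (c t ω)
        = ∑ i ∈ Finset.Icc 1 N, r i * (if c t ω = i then (1 : ℝ) else 0) := by
      intro t ω
      by_cases h0 : c t ω = 0
      · simp [h0, hr0]
      · simp [hcval t ω, Nat.one_le_iff_ne_zero.2 h0]
    simp_rw [hpt]
    rw [havg, mul_div_cancel₀ _ hTpos.ne', integral_finsetSum _ fun t _ =>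
      integrable_finsetSum _ fun i _ => (hint t i).const_mul (r i)]
    refine Finset.sum_congr rfl fun t ht => ?_
    rw [integral_finsetSum _ fun i _ => (hint t i).const_mul (r i)]
    have hR : ∀ A ∈ F, μ.real (S t ⁻¹' {A}) * mnlRev v r A
        = ∑ i ∈ Finset.Icc 1 N, r i * (μ.real (S t ⁻¹' {A}) * mnlProb v i A) := by
      intro A hA
      rw [mnlRev_eq_sum_of_subset v r (Finset.mem_powerset.1 (Finset.mem_filter.1 hA).1),
        Finset.mul_sum]
      exact Finset.sum_congr rfl fun i _ => mul_left_comm _ _ _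
    rw [Finset.sum_congr rfl hR, Finset.sum_comm]
    refine Finset.sum_congr rfl fun i hi => ?_
    rw [integral_const_mul, hbuy t ht i hi, Finset.mul_sum]
  rw [hrev]
  refine mul_le_mul_of_nonneg_left (le_csSup ?_ ⟨y, ?_, ?_, ?_, rfl⟩) hTpos.le
  · refine ⟨∑ A ∈ F, |mnlRev v r A|, ?_⟩
    rintro x ⟨z, hz0, hz1, -, rfl⟩
    exact sum_mul_le_sum_abs_s9 F z _ hz0 hz1
  · exact fun A _ => div_nonneg (Finset.sum_nonneg fun t _ => measureReal_nonneg) hTpos.le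
  · have h := havg fun _ => 1
    simp_rw [← hexp _ fun _ => (1 : ℝ)] at h
    simpa [hTpos.ne'] using h
  · intro i hi
    rw [havg]
    refine div_le_div_of_nonneg_right ?_ hTpos.le
    rw [← Finset.sum_congr rfl fun t ht => hbuy t ht i hi,
      ← integral_finsetSum _ fun t _ => hint t i]
    calc _ ≤ ∫ _, q i ∂μ := integral_mono_ae (integrable_finsetSum _ fun t _ => hint t i)
            (integrable_const _) (hinv.mono fun ω h => h i hi)
      _ = q i := by simp
end

section
/- Let T ≥ 2 and K ≥ 1 be integers with K + 1 ≤ T, and let X_1, …, X_T be ℕ-valued random variables such that for each k there is a σ(X_1,…,X_{k−1})-measurable random variable p_k with values in (0,1] with P(X_k = m | X_1,…,X_{k−1}) = (1 − p_k)^m p_k for all m ∈ ℕ almost surely, and such that the conditional mean μ_k = (1 − p_k)/p_k lies in [1, K+1] almost surely. Then P( Σ_{k=1}^T X_k − Σ_{k=1}^T μ_k > (K+1) · √(16(K+1)T) · log T ) ≤ 1/T. -/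
open MeasureTheory Filter

lemma one_div_one_sub_le_exp_add_sq {u : ℝ} (h0 : 0 ≤ u) (h1 : u ≤ 1 / 2) :
    1 / (1 - u) ≤ Real.exp (u + u ^ 2) := by
  have h := Real.quadratic_le_exp_of_nonneg (x := u + u ^ 2) (by positivity)
  refine le_trans ?_ h
  rw [div_le_iff₀ (by linarith)]
  have h2 : 0 ≤ 1 - u - u ^ 2 - u ^ 3 := by
    have : u ^ 2 ≤ u / 2 := by nlinarith
    have : u ^ 3 ≤ u / 4 := by nlinarith
    linarith
  nlinarith [mul_nonneg (sq_nonneg u) h2]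

/-- The series defining the moment generating function of a geometric variable with success
probability `p` is bounded by a sub-Gaussian expression in its mean. -/
lemma tsum_geometric_mgf_le {p s M : ℝ} (hp0 : 0 < p) (hp1 : p ≤ 1)
    (hM : (1 - p) / p ≤ M) (hM2 : 2 ≤ M) (hs0 : 0 ≤ s) (hs : s ≤ 1 / 8)
    (hMs : M * s ≤ 1 / 4) :
    ∑' j : ℕ, ENNReal.ofReal (Real.exp (s * j) * ((1 - p) ^ j * p)) ≤
      ENNReal.ofReal (Real.exp (s * ((1 - p) / p) + 2 * M ^ 2 * s ^ 2)) := by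
  obtain ⟨m, hm⟩ : ∃ m, m = (1 - p) / p := ⟨_, rfl⟩
  rw [← hm] at hM ⊢
  have hm0 : 0 ≤ m := hm ▸ div_nonneg (by linarith) hp0.le
  have hmp : 1 - p = m * p := by rw [hm]; field_simp
  have hes : Real.exp s ≤ 1 + s + s ^ 2 := by
    have := (abs_le.1 (Real.abs_exp_sub_one_sub_id_le (x := s)
      (abs_le.2 ⟨by linarith, by linarith⟩))).2
    linarith
  have hes1 : 1 ≤ Real.exp s := Real.one_le_exp hs0
  set u := m * (Real.exp s - 1) with hu
  have hu0 : 0 ≤ u := mul_nonneg hm0 (by linarith)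
  have hms : m * s ≤ M * s := by gcongr
  have hms0 : 0 ≤ m * s := mul_nonneg hm0 hs0
  have huv : u ≤ m * s * (1 + s) := by
    calc u ≤ m * (s + s ^ 2) := by rw [hu]; gcongr; linarith
      _ = _ := by ring
  have hu2 : u ≤ 1 / 2 := by nlinarith
  have hr : Real.exp s * (1 - p) = 1 - p * (1 - u) := by
    rw [hmp, hu]; linear_combination (-1 : ℝ) * hmp
  have hsum : HasSum (fun j : ℕ => Real.exp (s * j) * ((1 - p) ^ j * p)) (1 / (1 - u)) := by
    have h := (hasSum_geometric_of_lt_one (r := Real.exp s * (1 - p))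
      (mul_nonneg (by linarith) (by linarith)) (by rw [hr]; nlinarith)).mul_right p
    have hval : 1 / (1 - u) = (1 - Real.exp s * (1 - p))⁻¹ * p := by
      have : 1 - u ≠ 0 := by linarith
      rw [hr, sub_sub_cancel]
      field_simp
    rw [hval]
    refine h.congr_fun fun j => ?_
    rw [mul_pow, ← Real.exp_nat_mul, mul_comm s]
    ring
  rw [← ENNReal.ofReal_tsum_of_nonneg (fun j => mul_nonneg (Real.exp_nonneg _)
    (mul_nonneg (pow_nonneg (by linarith) _) hp0.le)) hsum.summable, hsum.tsum_eq]
  refine ENNReal.ofReal_le_ofReal ((one_div_one_sub_le_exp_add_sq hu0 hu2).trans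
    (Real.exp_le_exp.2 ?_))
  have h1 : u ^ 2 ≤ (m * s * (1 + s)) ^ 2 := by gcongr
  have h2 : (m * s) ^ 2 ≤ (M * s) ^ 2 := by gcongr
  have h3 : (1 + s) ^ 2 ≤ 81 / 64 := by nlinarith
  have h4 : (m * s * (1 + s)) ^ 2 ≤ (M * s) ^ 2 * (81 / 64) := by
    rw [mul_pow]; gcongr
  have h5 : m * s * s ≤ (M * s) ^ 2 / 2 := by
    have : m * s * s ≤ M * s * s := by gcongr
    nlinarith [mul_nonneg (mul_nonneg (by linarith : (0 : ℝ) ≤ M) (sq_nonneg s))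
      (by linarith : (0 : ℝ) ≤ M - 2)]
  nlinarith [sq_nonneg (M * s)]

/-- Integrating a sub-σ-algebra-measurable function over an event amounts to weighting it by the
conditional probability of the event. -/
lemma setLIntegral_eq_lintegral_mul_of_condExp {Ω : Type*} {m m0 : MeasurableSpace Ω}
    {μ : Measure Ω} [IsFiniteMeasure μ] (hm : m ≤ m0) {B : Set Ω} (hB : MeasurableSet B)
    {q : Ω → ℝ} (hq : Measurable[m] q) (hq0 : 0 ≤ᵐ[μ] q)
    (h : μ[B.indicator (fun _ => (1 : ℝ)) | m] =ᵐ[μ] q)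
    {Z : Ω → ENNReal} (hZ : Measurable[m] Z) :
    ∫⁻ ω in B, Z ω ∂μ = ∫⁻ ω, ENNReal.ofReal (q ω) * Z ω ∂μ := by
  have hq' : Measurable (fun ω => ENNReal.ofReal (q ω)) := (hq.mono hm le_rfl).ennreal_ofReal
  have hint : Integrable (B.indicator (fun _ => (1 : ℝ))) μ :=
    (integrable_const _).indicator hB
  have hqi : Integrable q μ := integrable_condExp.congr h
  have key : (μ.restrict B).trim hm =
      (μ.withDensity (fun ω => ENNReal.ofReal (q ω))).trim hm := by
    refine @Measure.ext _ m _ _ fun A hA => ?_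
    rw [trim_measurableSet_eq hm hA, trim_measurableSet_eq hm hA,
      Measure.restrict_apply (hm _ hA), withDensity_apply _ (hm _ hA),
      ← ofReal_integral_eq_lintegral_ofReal hqi.integrableOn (ae_restrict_of_ae hq0),
      ← setIntegral_congr_ae (hm _ hA) (h.mono fun _ hω _ => hω),
      setIntegral_condExp hm hint hA, setIntegral_indicator hB]
    simp
  calc ∫⁻ ω in B, Z ω ∂μ = ∫⁻ ω, Z ω ∂((μ.restrict B).trim hm) := (lintegral_trim hm hZ).symm
    _ = ∫⁻ ω, Z ω ∂(μ.withDensity (fun ω => ENNReal.ofReal (q ω))) := by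
      rw [key, lintegral_trim hm hZ]
    _ = _ := lintegral_withDensity_eq_lintegral_mul _ hq' (hZ.mono hm le_rfl)

/-- One step of the exponential supermartingale for conditionally geometric variables. -/
lemma lintegral_mul_exp_geometric_le {Ω : Type*} {m m0 : MeasurableSpace Ω}
    {μ : Measure Ω} [IsFiniteMeasure μ] (hm : m ≤ m0) {X : Ω → ℕ} (hX : Measurable X)
    {p : Ω → ℝ} (hpm : Measurable[m] p) {s M : ℝ}
    (hp : ∀ᵐ ω ∂μ, 0 < p ω ∧ p ω ≤ 1) (hmean : ∀ᵐ ω ∂μ, (1 - p ω) / p ω ≤ M)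
    (hgeom : ∀ j : ℕ, μ[(fun ω => if X ω = j then (1 : ℝ) else 0) | m]
      =ᵐ[μ] fun ω => (1 - p ω) ^ j * p ω)
    (hM2 : 2 ≤ M) (hs0 : 0 ≤ s) (hs : s ≤ 1 / 8) (hMs : M * s ≤ 1 / 4)
    {Y : Ω → ℝ} (hY : Measurable[m] Y) :
    ∫⁻ ω, ENNReal.ofReal (Real.exp (s * (Y ω + (X ω - (1 - p ω) / p ω)))) ∂μ ≤
      ENNReal.ofReal (Real.exp (2 * M ^ 2 * s ^ 2)) *
        ∫⁻ ω, ENNReal.ofReal (Real.exp (s * Y ω)) ∂μ := by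
  set Z : Ω → ENNReal := fun ω => ENNReal.ofReal (Real.exp (s * (Y ω - (1 - p ω) / p ω)))
    with hZdef
  have hZ : Measurable[m] Z := by
    refine Measurable.ennreal_ofReal (Real.measurable_exp.comp (Measurable.const_mul ?_ s))
    exact hY.sub ((measurable_const.sub hpm).div hpm)
  have hZ' : Measurable Z := hZ.mono hm le_rfl
  have hq (j : ℕ) : Measurable[m] fun ω => (1 - p ω) ^ j * p ω :=
    ((measurable_const.sub hpm).pow_const j).mul hpm
  have hpreimage (j : ℕ) : MeasurableSet (X ⁻¹' {j}) := hX (measurableSet_singleton j)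
  have hindicator (j : ℕ) : (X ⁻¹' {j}).indicator (fun _ => (1 : ℝ)) =
      fun ω => if X ω = j then (1 : ℝ) else 0 := by
    funext ω
    by_cases h : X ω = j
    · rw [Set.indicator_of_mem (show ω ∈ X ⁻¹' {j} from h), if_pos h]
    · rw [Set.indicator_of_notMem (show ω ∉ X ⁻¹' {j} from h), if_neg h]
  calc ∫⁻ ω, ENNReal.ofReal (Real.exp (s * (Y ω + (X ω - (1 - p ω) / p ω)))) ∂μ
      = ∫⁻ ω, ∑' j : ℕ, (X ⁻¹' {j}).indicator
          (fun ω => ENNReal.ofReal (Real.exp (s * j)) * Z ω) ω ∂μ := by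
        refine lintegral_congr fun ω => ?_
        have hne (j : ℕ) (hj : j ≠ X ω) : ω ∉ X ⁻¹' {j} :=
          fun h => hj (Set.mem_singleton_iff.1 h).symm
        rw [tsum_eq_single (X ω) fun j hj => Set.indicator_of_notMem (hne j hj) _,
          Set.indicator_of_mem (by simp), hZdef, ← ENNReal.ofReal_mul (Real.exp_nonneg _),
          ← Real.exp_add]
        congr 2
        ring
    _ = ∑' j : ℕ, ∫⁻ ω, ENNReal.ofReal (Real.exp (s * j) * ((1 - p ω) ^ j * p ω)) * Z ω ∂μ := by
        rw [lintegral_tsum fun j => ((hZ'.const_mul _).indicator (hpreimage j)).aemeasurable]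
        refine tsum_congr fun j => ?_
        rw [lintegral_indicator (hpreimage j), lintegral_const_mul _ hZ',
          setLIntegral_eq_lintegral_mul_of_condExp hm (hpreimage j) (hq j) ?_ ?_ hZ,
          ← lintegral_const_mul' _ _ ENNReal.ofReal_ne_top]
        · refine lintegral_congr fun ω => ?_
          rw [ENNReal.ofReal_mul (Real.exp_nonneg _), mul_assoc]
        · filter_upwards [hp] with ω hω
          exact mul_nonneg (pow_nonneg (by linarith) _) hω.1.le
        · rw [hindicator]
          exact hgeom j
    _ = ∫⁻ ω, (∑' j : ℕ, ENNReal.ofReal (Real.exp (s * j) * ((1 - p ω) ^ j * p ω))) * Z ω ∂μ := by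
        symm
        exact (lintegral_congr fun ω => ENNReal.tsum_mul_right.symm).trans
          (lintegral_tsum fun j => ((((hq j).mono hm le_rfl).const_mul
            _).ennreal_ofReal.mul hZ').aemeasurable)
    _ ≤ ∫⁻ ω, ENNReal.ofReal (Real.exp (2 * M ^ 2 * s ^ 2)) *
          ENNReal.ofReal (Real.exp (s * Y ω)) ∂μ := by
        refine lintegral_mono_ae ?_
        filter_upwards [hp, hmean] with ω h1 h2
        refine (mul_le_mul_left (tsum_geometric_mgf_le h1.1 h1.2 h2 hM2 hs0 hs hMs) _).trans ?_
        rw [hZdef, ← ENNReal.ofReal_mul (Real.exp_nonneg _),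
          ← ENNReal.ofReal_mul (Real.exp_nonneg _), ← Real.exp_add, ← Real.exp_add]
        refine le_of_eq ?_
        congr 2
        ring
    _ = _ := lintegral_const_mul _
        (Real.measurable_exp.comp ((hY.mono hm le_rfl).const_mul s)).ennreal_ofReal

/-- Concentration bound for the total length of the epochs: tail bound for a
sum of conditionally geometric random variables with means in `[1, K+1]`. -/
theorem stmt_12 {Ω : Type*} [MeasurableSpace Ω] (μ : Measure Ω) [IsProbabilityMeasure μ]
    (T K : ℕ) (hT : 2 ≤ T) (hK : 1 ≤ K) (hKT : K + 1 ≤ T)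
    (X : ℕ → Ω → ℕ) (p : ℕ → Ω → ℝ)
    (hXmeas : ∀ k, Measurable (X k))
    (hpmeas : ∀ k,
      Measurable[⨆ j ∈ Finset.Icc 1 (k - 1), MeasurableSpace.comap (X j) ⊤] (p k))
    (hp : ∀ᵐ ω ∂μ, ∀ k ∈ Finset.Icc 1 T, 0 < p k ω ∧ p k ω ≤ 1)
    (hmean : ∀ᵐ ω ∂μ, ∀ k ∈ Finset.Icc 1 T,
      1 ≤ (1 - p k ω) / p k ω ∧ (1 - p k ω) / p k ω ≤ (K : ℝ) + 1)
    (hgeom : ∀ k ∈ Finset.Icc 1 T, ∀ m : ℕ,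
      μ[(fun ω => if X k ω = m then (1 : ℝ) else 0) |
          ⨆ j ∈ Finset.Icc 1 (k - 1), MeasurableSpace.comap (X j) ⊤]
        =ᵐ[μ] fun ω => (1 - p k ω) ^ m * p k ω) :
    μ {ω | ((K : ℝ) + 1) * Real.sqrt (16 * ((K : ℝ) + 1) * T) * Real.log T
            < (∑ k ∈ Finset.Icc 1 T, (X k ω : ℝ))
              - ∑ k ∈ Finset.Icc 1 T, (1 - p k ω) / p k ω}
      ≤ (T : ENNReal)⁻¹ := by
  set F : ℕ → MeasurableSpace Ω :=
    fun k => ⨆ j ∈ Finset.Icc 1 (k - 1), MeasurableSpace.comap (X j) ⊤ with hF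
  have hFle (k : ℕ) : F k ≤ ‹MeasurableSpace Ω› :=
    iSup₂_le fun j _ => (hXmeas j).comap_le
  have hFmono {a b : ℕ} (hab : a ≤ b) : F a ≤ F b := by
    refine biSup_mono fun j hj => ?_
    simp only [Finset.mem_Icc] at hj ⊢
    omega
  have hXF {j k : ℕ} (hj : 1 ≤ j) (hjk : j < k) : Measurable[F k] (X j) := by
    have h : MeasurableSpace.comap (X j) ⊤ ≤ F k :=
      le_iSup₂_of_le j (Finset.mem_Icc.2 ⟨hj, by omega⟩) le_rfl
    exact (comap_measurable (X j)).mono h le_rfl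
  set S : ℕ → Ω → ℝ :=
    fun n ω => ∑ k ∈ Finset.Icc 1 n, ((X k ω : ℝ) - (1 - p k ω) / p k ω) with hS
  have hSF (n : ℕ) : Measurable[F (n + 1)] (S n) := by
    refine Finset.measurable_fun_sum _ fun k hk => ?_
    obtain ⟨hk1, hkn⟩ := Finset.mem_Icc.1 hk
    have hpk : Measurable[F (n + 1)] (p k) := (hpmeas k).mono (hFmono (by omega)) le_rfl
    exact ((measurable_from_top (f := fun i : ℕ => (i : ℝ))).comp (hXF hk1 (by omega))).sub
      ((measurable_const.sub hpk).div hpk)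
  obtain ⟨M, hMdef⟩ : ∃ M : ℝ, M = (K : ℝ) + 1 := ⟨_, rfl⟩
  have hM2 : 2 ≤ M := by
    have : (1 : ℝ) ≤ K := by exact_mod_cast hK
    linarith
  have hMT : M ≤ T := by rw [hMdef]; exact_mod_cast hKT
  have hT2 : (2 : ℝ) ≤ T := by exact_mod_cast hT
  rw [← hMdef] at hmean ⊢
  set r := Real.sqrt (M * T) with hr
  have hrsq : r ^ 2 = M * T := Real.sq_sqrt (by positivity)
  have hr2 : 2 ≤ r := Real.le_sqrt_of_sq_le (by nlinarith)
  have hsqrt : Real.sqrt (16 * M * T) = 4 * r := by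
    rw [mul_assoc, Real.sqrt_mul (by norm_num), show (16 : ℝ) = 4 ^ 2 by norm_num,
      Real.sqrt_sq (by norm_num)]
  set s : ℝ := 1 / (2 * M * r) with hs
  have hs0 : 0 < s := by positivity
  have hs8 : s ≤ 1 / 8 := one_div_le_one_div_of_le (by norm_num) (by nlinarith)
  have hMs : M * s ≤ 1 / 4 := by
    rw [hs, mul_one_div, div_le_iff₀ (by positivity)]
    nlinarith
  have hind (n : ℕ) (hn : n ≤ T) : ∫⁻ ω, ENNReal.ofReal (Real.exp (s * S n ω)) ∂μ ≤
      ENNReal.ofReal (Real.exp (2 * M ^ 2 * s ^ 2)) ^ n := by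
    induction n with
    | zero => simp [hS]
    | succ n ih =>
      have hmem : n + 1 ∈ Finset.Icc 1 T := Finset.mem_Icc.2 ⟨by omega, hn⟩
      have hstep := lintegral_mul_exp_geometric_le (hFle (n + 1)) (hXmeas (n + 1))
        (hpmeas (n + 1)) (hp.mono fun ω h => h _ hmem) (hmean.mono fun ω h => (h _ hmem).2)
        (hgeom _ hmem) hM2 hs0.le hs8 hMs (hSF n)
      calc _ = _ := by
            refine lintegral_congr fun ω => ?_
            simp only [hS]
            rw [Finset.sum_Icc_succ_top (by omega)]
        _ ≤ _ := hstep
        _ ≤ _ := by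
          rw [pow_succ' _ n]
          exact mul_le_mul_right (ih (by omega)) _
  set t := M * Real.sqrt (16 * M * T) * Real.log T with ht
  have hst : s * t = 2 * Real.log T := by
    rw [ht, hsqrt, hs]
    field_simp
    norm_num
  have hsq : (T : ℝ) * (2 * M ^ 2 * s ^ 2) ≤ 1 / 4 := by
    have : (T : ℝ) * (2 * M ^ 2 * s ^ 2) = 1 / (2 * M) := by
      rw [hs, div_pow, mul_pow, mul_pow, hrsq]
      field_simp
    rw [this]
    exact one_div_le_one_div_of_le (by norm_num) (by linarith)
  have hlog : 1 / 4 ≤ Real.log T := by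
    have h1 := Real.log_le_log (by norm_num) hT2
    have h2 := Real.log_two_gt_d9
    linarith
  have hSmeas : Measurable fun ω => ENNReal.ofReal (Real.exp (s * S T ω)) :=
    (Real.measurable_exp.comp (((hSF T).mono (hFle _) le_rfl).const_mul s)).ennreal_ofReal
  calc _ ≤ μ {ω | ENNReal.ofReal (Real.exp (s * t)) ≤
          ENNReal.ofReal (Real.exp (s * S T ω))} := by
        refine measure_mono fun ω hω => ?_
        rw [Set.mem_ofPred_eq, ← Finset.sum_sub_distrib] at hω
        exact ENNReal.ofReal_le_ofReal (Real.exp_le_exp.2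
          (mul_le_mul_of_nonneg_left hω.le hs0.le))
    _ ≤ (∫⁻ ω, ENNReal.ofReal (Real.exp (s * S T ω)) ∂μ) / ENNReal.ofReal (Real.exp (s * t)) :=
        meas_ge_le_lintegral_div hSmeas.aemeasurable
          (by simpa using Real.exp_pos _) ENNReal.ofReal_ne_top
    _ ≤ ENNReal.ofReal (Real.exp (2 * M ^ 2 * s ^ 2)) ^ T /
          ENNReal.ofReal (Real.exp (s * t)) := by
        gcongr
        exact hind T le_rfl
    _ = ENNReal.ofReal (Real.exp (T * (2 * M ^ 2 * s ^ 2) - s * t)) := by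
        rw [← ENNReal.ofReal_pow (Real.exp_nonneg _), ← Real.exp_nat_mul,
          ← ENNReal.ofReal_div_of_pos (Real.exp_pos _), Real.exp_sub]
    _ ≤ ENNReal.ofReal (Real.exp (-Real.log T)) :=
        ENNReal.ofReal_le_ofReal (Real.exp_le_exp.2 (by linarith))
    _ = (T : ENNReal)⁻¹ := by
        rw [Real.exp_neg, Real.exp_log (by positivity),
          ENNReal.ofReal_inv_of_pos (by positivity), ENNReal.ofReal_natCast]
end
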